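/- arXiv:0711.4929 — 2 statements merged into one kernel-verified Lean document; each statement's English description precedes it below -/
import Mathlib

section
/- For every integer n ≥ 1, the pair (r_n, s_n) is a regular sequence in ℚ[ξ,α]: r_n is a nonzerodivisor, s_n is a nonzerodivisor modulo ⟨r_n⟩, and the ideal ⟨r_n, s_n⟩ is proper; in particular r_n and s_n have no common non-unit divisor. -/
open MvPolynomial

/-- The variable `ξ` of `ℚ[ξ,α]`. -/
noncomputable def xiVar : MvPolynomial (Fin 2) ℚ := X 0
/-- The variable `α` of `ℚ[ξ,α]`. -/
noncomputable def alVar : MvPolynomial (Fin 2) ℚ := X 1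

theorem relPrime_xi_al : IsRelPrime xiVar alVar := by
  have hp : Prime (X 0 : MvPolynomial (Fin 2) ℚ) := MvPolynomial.X_prime
  unfold xiVar alVar
  rw [hp.irreducible.isRelPrime_iff_not_dvd]
  rw [MvPolynomial.X_dvd_X]
  simp

theorem relPrime_aux {f g : MvPolynomial (Fin 2) ℚ} (a b a' b' c : ℚ) (hc : c ≠ 0)
    (h1 : C a * f + C b * g = C c * xiVar) (h2 : C a' * f + C b' * g = C c * alVar) :
    IsRelPrime f g := by
  intro d hf hg
  have key : ∀ y : MvPolynomial (Fin 2) ℚ, d ∣ C c * y → d ∣ y := by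
    intro y hy
    have : y = C c⁻¹ * (C c * y) := by
      rw [← mul_assoc, ← C_mul, inv_mul_cancel₀ hc, C_1, one_mul]
    rw [this]
    exact hy.mul_left _
  apply relPrime_xi_al
  · apply key
    rw [← h1]
    exact dvd_add (hf.mul_left _) (hg.mul_left _)
  · apply key
    rw [← h2]
    exact dvd_add (hf.mul_left _) (hg.mul_left _)

theorem relPrime_AB (n : ℕ) : IsRelPrime
    ((xiVar + alVar) ^ n * (xiVar + 3 * alVar) ^ n)
    ((xiVar - alVar) ^ n * (xiVar - 3 * alVar) ^ n) := by
  have e : (3 : MvPolynomial (Fin 2) ℚ) = C 3 := (map_ofNat C 3).symm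
  have e2 : (C 2 : MvPolynomial (Fin 2) ℚ) = 2 := map_ofNat C 2
  have e3 : (C 3 : MvPolynomial (Fin 2) ℚ) = 3 := map_ofNat C 3
  have e4 : (C 4 : MvPolynomial (Fin 2) ℚ) = 4 := map_ofNat C 4
  have e6 : (C 6 : MvPolynomial (Fin 2) ℚ) = 6 := map_ofNat C 6
  have h11 : IsRelPrime (xiVar + alVar) (xiVar - alVar) :=
    relPrime_aux 1 1 1 (-1) 2 (by norm_num)
      (by simp only [C_neg, C_1, e2]; ring) (by simp only [C_neg, C_1, e2]; ring)
  have h13 : IsRelPrime (xiVar + alVar) (xiVar - 3 * alVar) :=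
    relPrime_aux 3 1 1 (-1) 4 (by norm_num)
      (by simp only [C_1, e3, e4]; ring) (by simp only [C_neg, C_1, e4]; ring)
  have h31 : IsRelPrime (xiVar + 3 * alVar) (xiVar - alVar) :=
    relPrime_aux 1 3 1 (-1) 4 (by norm_num)
      (by simp only [C_1, e3, e4]; ring) (by simp only [C_neg, C_1, e4]; ring)
  have h33 : IsRelPrime (xiVar + 3 * alVar) (xiVar - 3 * alVar) :=
    relPrime_aux 3 3 1 (-1) 6 (by norm_num)
      (by simp only [e3, e6]; ring) (by simp only [C_neg, C_1, e6]; ring)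
  exact IsRelPrime.mul_left (IsRelPrime.mul_right h11.pow h13.pow)
    (IsRelPrime.mul_right h31.pow h33.pow)

/-- For `n ≥ 1`, the relations `r_n`, `s_n` of presentation (2.5) of Kiem–Moon — defined by
`2α·r_n = (ξ+α)^n(ξ+3α)^n − (ξ−α)^n(ξ−3α)^n` and
`2·s_n = (ξ+α)^n(ξ+3α)^n + (ξ−α)^n(ξ−3α)^n` — form a regular sequence in `ℚ[ξ,α]`:
`r_n` is a nonzerodivisor, `s_n` is a nonzerodivisor modulo `⟨r_n⟩`, the ideal `⟨r_n,s_n⟩`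
is proper; in particular `r_n` and `s_n` have no common non-unit divisor. -/
theorem stmt6 (n : ℕ) (hn : 1 ≤ n) (r s : MvPolynomial (Fin 2) ℚ)
    (hr : 2 * alVar * r =
      (xiVar + alVar) ^ n * (xiVar + 3 * alVar) ^ n -
        (xiVar - alVar) ^ n * (xiVar - 3 * alVar) ^ n)
    (hs : 2 * s =
      (xiVar + alVar) ^ n * (xiVar + 3 * alVar) ^ n +
        (xiVar - alVar) ^ n * (xiVar - 3 * alVar) ^ n) :
    (∀ x : MvPolynomial (Fin 2) ℚ, x * r = 0 → x = 0) ∧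
    (∀ x : MvPolynomial (Fin 2) ℚ,
      x * s ∈ Ideal.span ({r} : Set (MvPolynomial (Fin 2) ℚ)) →
      x ∈ Ideal.span ({r} : Set (MvPolynomial (Fin 2) ℚ))) ∧
    Ideal.span ({r, s} : Set (MvPolynomial (Fin 2) ℚ)) ≠ ⊤ ∧
    (∀ d : MvPolynomial (Fin 2) ℚ, d ∣ r → d ∣ s → IsUnit d) := by
  have hrel : IsRelPrime r s := by
    intro d hdr hds
    obtain ⟨u, hu⟩ := hdr
    obtain ⟨v, hv⟩ := hds
    have e2 : (C (2⁻¹) : MvPolynomial (Fin 2) ℚ) * 2 = 1 := by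
      rw [← map_ofNat C 2, ← C_mul]; norm_num
    apply relPrime_AB n
    · refine ⟨alVar * u + v, ?_⟩
      linear_combination (C (2⁻¹)) * (-hr - hs) + alVar * hu + hv + (alVar * r + s
        - (xiVar + alVar) ^ n * (xiVar + 3 * alVar) ^ n) * e2
    · refine ⟨v - alVar * u, ?_⟩
      linear_combination (C (2⁻¹)) * (hr - hs) - alVar * hu + hv + (s - alVar * r
        - (xiVar - alVar) ^ n * (xiVar - 3 * alVar) ^ n) * e2
  have hr0 : r ≠ 0 := by
    rintro rfl
    have := congrArg (eval (fun _ => (1 : ℚ))) hr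
    simp [xiVar, alVar] at this
    norm_num at this
    have hn0 : n ≠ 0 := by omega
    simp [hn0] at this
  refine ⟨?_, ?_, ?_, hrel⟩
  · intro x hx
    exact (mul_eq_zero.mp hx).resolve_right hr0
  · intro x hx
    rw [Ideal.mem_span_singleton] at hx ⊢
    exact hrel.dvd_of_dvd_mul_right hx
  · have hn0 : n ≠ 0 := by omega
    have hr' : eval (fun _ => (0 : ℚ)) r = 0 := by
      have h := congrArg (aeval (![0, Polynomial.X] : Fin 2 → Polynomial ℚ)) hr
      have h' : aeval (![0, Polynomial.X] : Fin 2 → Polynomial ℚ) r = 0 := by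
        simp [xiVar, alVar] at h
        rw [← mul_pow, ← mul_pow, neg_mul_neg, sub_self] at h
        simpa using h
      have h2 := congrArg (Polynomial.aeval (0 : ℚ)) h'
      rw [MvPolynomial.comp_aeval_apply] at h2
      rw [map_zero] at h2
      have hfun : (fun i => (Polynomial.aeval (0 : ℚ))
          ((![0, Polynomial.X] : Fin 2 → Polynomial ℚ) i)) = fun _ => (0 : ℚ) := by
        funext i
        fin_cases i <;> simp
      rw [hfun] at h2
      rw [← MvPolynomial.coe_aeval_eq_eval]
      exact h2
    have hs' : eval (fun _ => (0 : ℚ)) s = 0 := by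
      have := congrArg (eval (fun _ => (0 : ℚ))) hs
      rw [map_mul, map_ofNat] at this
      simpa [xiVar, alVar, hn0] using this
    intro htop
    have hle : Ideal.span ({r, s} : Set (MvPolynomial (Fin 2) ℚ)) ≤
        RingHom.ker (eval (fun _ : Fin 2 => (0 : ℚ))) := by
      rw [Ideal.span_le]
      rintro y (rfl | rfl)
      · exact hr'
      · exact hs'
    rw [htop] at hle
    have h1 : (1 : MvPolynomial (Fin 2) ℚ) ∈ RingHom.ker (eval (fun _ : Fin 2 => (0 : ℚ))) :=
      hle trivial
    rw [RingHom.mem_ker, map_one] at h1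
    exact one_ne_zero h1
end

section
/- For every integer n ≥ 1, the quotient ring ℚ[ξ,α]/⟨r_n, s_n⟩ is a finite-dimensional ℚ-vector space of dimension 2n·(2n−1). -/
open MvPolynomial

abbrev PP := MvPolynomial (Fin 2) ℚ

def HasDim (f g : PP) (d : ℕ) : Prop :=
  Module.rank ℚ (PP ⧸ Ideal.span ({f, g} : Set PP)) = (d : Cardinal)

lemma HasDim.swap {f g : PP} {d : ℕ} (h : HasDim f g d) : HasDim g f d := by
  unfold HasDim at *
  rwa [Set.pair_comm]

lemma hasDim_unit {f g : PP} (h : IsUnit f) : HasDim f g 0 := by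
  unfold HasDim
  have : Ideal.span ({f, g} : Set PP) = ⊤ :=
    Ideal.eq_top_of_isUnit_mem _ (Ideal.subset_span (by simp)) h
  have : Subsingleton (PP ⧸ Ideal.span ({f, g} : Set PP)) :=
    Ideal.Quotient.subsingleton_iff.2 this
  simp

lemma hasDim_congr {f g g' c : PP} {d : ℕ} (e : g' = g + c * f) (h : HasDim f g d) :
    HasDim f g' d := by
  unfold HasDim at *
  rw [e]
  have : Ideal.span ({f, g + c * f} : Set PP) = Ideal.span ({f, g} : Set PP) := by
    simp
  rw [this]; exact h

lemma hasDim_add {p q h : PP} {a b : ℕ} (hpq : IsRelPrime p q) (hp : q ≠ 0)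
    (h1 : HasDim p q a) (h2 : HasDim p h b) : HasDim p (q * h) (a + b) := by
  unfold HasDim at *
  set I := Ideal.span ({p, h} : Set PP) with hI
  set J := Ideal.span ({p, q * h} : Set PP) with hJ
  set K := Ideal.span ({p, q} : Set PP) with hK
  have hJK : J ≤ K := by
    rw [hJ, Ideal.span_le]
    rintro x (rfl | rfl)
    · exact Ideal.subset_span (by simp)
    · exact Ideal.mul_mem_right _ _ (Ideal.subset_span (by simp))
  let π : (PP ⧸ J) →ₗ[ℚ] (PP ⧸ K) := (Ideal.Quotient.factorₐ ℚ hJK).toLinearMap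
  let φ' : PP →ₗ[ℚ] (PP ⧸ J) :=
    (Ideal.Quotient.mkₐ ℚ J).toLinearMap ∘ₗ LinearMap.mulLeft ℚ q
  have hφ' : ∀ x, φ' x = Ideal.Quotient.mk J (q * x) := fun x => rfl
  have hker : LinearMap.ker φ' = I.restrictScalars ℚ := by
    ext x
    rw [LinearMap.mem_ker, hφ', Ideal.Quotient.eq_zero_iff_mem, Submodule.restrictScalars_mem,
      hJ, hI, Ideal.mem_span_pair, Ideal.mem_span_pair]
    constructor
    · rintro ⟨u, v, e⟩
      have : q ∣ u * p := ⟨x - v * h, by linear_combination e⟩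
      obtain ⟨w, rfl⟩ := hpq.symm.dvd_of_dvd_mul_right this
      exact ⟨w, v, mul_left_cancel₀ hp (by linear_combination e)⟩
    · rintro ⟨u, v, e⟩
      exact ⟨q * u, v, by linear_combination q * e⟩
  have hrange : LinearMap.range φ' = LinearMap.ker π := by
    ext y
    obtain ⟨x, rfl⟩ := Ideal.Quotient.mk_surjective y
    have : π (Ideal.Quotient.mk J x) = Ideal.Quotient.mk K x := rfl
    rw [LinearMap.mem_ker, this, Ideal.Quotient.eq_zero_iff_mem, hK, Ideal.mem_span_pair]
    constructor
    · rintro ⟨z, e⟩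
      rw [hφ', Ideal.Quotient.eq, hJ, Ideal.mem_span_pair] at e
      obtain ⟨u, v, e⟩ := e
      exact ⟨-u, z - v * h, by linear_combination -e⟩
    · rintro ⟨u, v, e⟩
      refine ⟨v, ?_⟩
      rw [hφ', Ideal.Quotient.eq, hJ, Ideal.mem_span_pair]
      exact ⟨-u, 0, by linear_combination -e⟩
  have hsurj : Function.Surjective π := Ideal.Quotient.factor_surjective hJK
  have r1 := LinearMap.rank_range_add_rank_ker π
  have r2 : Module.rank ℚ (LinearMap.ker π) = Module.rank ℚ (PP ⧸ I) := by
    rw [← hrange]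
    have e := φ'.quotKerEquivRange
    rw [hker] at e
    exact e.rank_eq.symm
  rw [LinearMap.range_eq_top.2 hsurj, rank_top, r2, h1, h2] at r1
  rw [← r1]; push_cast; rfl

lemma not_dvd10 : ¬ (X 1 : PP) ∣ X 0 := by
  rw [MvPolynomial.X_dvd_X]; simp

lemma X1_irr : Irreducible (X 1 : PP) := (MvPolynomial.X_prime (i := (1 : Fin 2))).irreducible

lemma hasDim_X (a : ℕ) : HasDim (X 1) ((X 0) ^ a) a := by
  induction a with
  | zero => exact (hasDim_unit (by simp)).swap
  | succ a ih =>
    rw [pow_succ', add_comm]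
    refine hasDim_add (X1_irr.isRelPrime_iff_not_dvd.2 not_dvd10) (X_ne_zero _) ?_ ih
    unfold HasDim
    have hk : Ideal.span ({X 1, X 0} : Set PP) = RingHom.ker (aeval (fun _ => (0:ℚ)) : PP →ₐ[ℚ] ℚ) := by
      apply le_antisymm
      · rw [Ideal.span_le]
        rintro x (rfl | rfl) <;> simp [RingHom.mem_ker]
      · intro p hp
        have key : ∀ p : PP, p - C (aeval (fun _ => (0:ℚ)) p) ∈ Ideal.span ({X 1, X 0} : Set PP) := by
          intro p
          induction p using MvPolynomial.induction_on with
          | C a => simp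
          | add p q hp hq =>
            have := Ideal.add_mem _ hp hq
            rw [map_add, C_add]; convert this using 1; ring
          | mul_X p i hp =>
            simp only [map_mul, aeval_X, mul_zero, C_0, sub_zero]
            apply Ideal.mul_mem_left
            apply Ideal.subset_span
            fin_cases i <;> simp
        have := key p
        rw [RingHom.mem_ker] at hp
        have hp' : (aeval (fun _ => (0:ℚ))) p = 0 := hp
        simpa [hp'] using this
    have hs : Function.Surjective (aeval (fun _ => (0:ℚ)) : PP →ₐ[ℚ] ℚ) := fun x => ⟨C x, by simp⟩
    rw [hk]
    have e := (Ideal.quotientKerAlgEquivOfSurjective hs).toLinearEquiv.rank_eq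
    refine e.trans ?_
    simp

lemma homog_cancel {p : PP} {b : ℕ} (h : (X 1 * p).IsHomogeneous (b + 1)) :
    p.IsHomogeneous b := by
  intro d hd
  have := @h (Finsupp.single 1 1 + d) (by rwa [coeff_X_mul])
  rw [map_add, Finsupp.weight_single] at this
  simp at this
  omega

lemma homog_decomp {p : PP} {b : ℕ} (h : p.IsHomogeneous b) :
    ∃ (c : ℚ) (q : PP), p = C c * X 0 ^ b + X 1 * q := by
  refine ⟨coeff (Finsupp.single 0 b) p, ?_⟩
  have : (X 1 : PP) ∣ p - C (coeff (Finsupp.single 0 b) p) * X 0 ^ b := by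
    rw [MvPolynomial.X_dvd_iff_modMonomial_eq_zero]
    ext m
    by_cases hm : Finsupp.single 1 1 ≤ m
    · rw [coeff_modMonomial_of_le _ hm]; simp
    · rw [coeff_modMonomial_of_not_le _ hm]
      rw [coeff_sub, coeff_C_mul, coeff_X_pow]
      have h1 : m 1 = 0 := by
        simpa using hm
      have h0 : m = Finsupp.single 0 (m 0) := by
        ext i; fin_cases i <;> simp [h1]
      by_cases hb : m 0 = b
      · rw [hb] at h0; rw [h0]; simp
      · have hc : coeff m p = 0 := by
          by_contra hc
          have := h hc
          rw [h0, Finsupp.weight_single] at this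
          simp at this; exact hb this
        rw [hc, if_neg]
        · simp
        · intro e; apply hb; rw [← e]; simp
  obtain ⟨q, hq⟩ := this
  exact ⟨q, by linear_combination hq⟩

lemma hasDim_main : ∀ (N a b : ℕ) (f g : PP), a + b = N → f.IsHomogeneous a → g.IsHomogeneous b →
    ¬ (X 1 : PP) ∣ f → IsRelPrime f g → HasDim f g (a * b) := by
  intro N
  induction N with
  | zero =>
    intro a b f g hN hf hg hx hfg
    obtain ⟨rfl, rfl⟩ : a = 0 ∧ b = 0 := by omega
    obtain ⟨c, q, e⟩ := homog_decomp hf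
    rw [← totalDegree_zero_iff_isHomogeneous, totalDegree_eq_zero_iff_eq_C] at hf
    apply hasDim_unit
    rw [hf]
    apply IsUnit.map
    rw [isUnit_iff_ne_zero]
    intro h0; rw [h0] at hf; apply hx; rw [hf]; simp
  | succ N ih =>
    -- divisible case
    have step : ∀ (a b : ℕ) (f g : PP), 0 < a → a + b = N + 1 → f.IsHomogeneous a →
        g.IsHomogeneous b → ¬ (X 1 : PP) ∣ f → IsRelPrime f g → 0 < b → X 1 ∣ g →
        HasDim f g (a * b) := by
      rintro a b f g ha hN hf hg hx hfg hb ⟨g, rfl⟩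
      obtain ⟨b, rfl⟩ := Nat.exists_eq_succ_of_ne_zero hb.ne'
      have hg' := homog_cancel hg
      have := ih a b f g (by omega) hf hg' hx (hfg.of_mul_right_right)
      rw [Nat.mul_succ, add_comm]
      refine hasDim_add hfg.of_mul_right_left (X_ne_zero _) ?_ this
      obtain ⟨c, q, e⟩ := homog_decomp hf
      have hc : c ≠ 0 := by
        rintro rfl
        apply hx; rw [e]; simp
      apply HasDim.swap
      refine hasDim_congr (c := q) (g := C c * X 0 ^ a) (by rw [e]; ring) ?_
      have := hasDim_X a
      unfold HasDim at *
      have e : Ideal.span ({X 1, C c * X 0 ^ a} : Set PP) = Ideal.span {X 1, X 0 ^ a} := by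
        have hu : IsUnit (C c : PP) := (isUnit_iff_ne_zero.2 hc).map C
        rw [Ideal.span_insert, Ideal.span_singleton_mul_left_unit hu, ← Ideal.span_insert]
      rw [e]; exact this
    have step2 : ∀ (a b : ℕ) (f g : PP), 0 < a → a ≤ b → a + b = N + 1 → f.IsHomogeneous a →
        g.IsHomogeneous b → ¬ (X 1 : PP) ∣ f → IsRelPrime f g → 
        HasDim f g (a * b) := by
      intro a b f g ha hab hN hf hg hx hfg
      obtain ⟨c, q, e⟩ := homog_decomp hf
      obtain ⟨d, q', e'⟩ := homog_decomp hg
      have hc : c ≠ 0 := by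
        rintro rfl
        apply hx; rw [e]; simp
      obtain ⟨k, rfl⟩ := Nat.exists_eq_add_of_le hab
      have hm : (C (d / c) * X 0 ^ k * f : PP).IsHomogeneous (a + k) := by
        rw [add_comm a k]
        refine IsHomogeneous.mul ?_ hf
        have := (isHomogeneous_C (Fin 2) (d / c)).mul (isHomogeneous_X_pow (R := ℚ) (0 : Fin 2) k)
        simpa using this
      refine hasDim_congr (c := C (d / c) * X 0 ^ k) (g := g - C (d / c) * X 0 ^ k * f) (by ring) ?_
      refine step a (a + k) f _ ha hN hf (hg.sub hm) hx ?_ (by omega) ?_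
      · intro t h1 h2
        refine hfg h1 ?_
        have := dvd_add h2 (h1.mul_left (C (d / c) * X 0 ^ k))
        simpa using this
      · refine ⟨q' - C (d / c) * X 0 ^ k * q, ?_⟩
        have hdc : (C d : PP) = C (d / c) * C c := by
          rw [← C_mul]; congr 1; field_simp
        rw [e, e', hdc]; ring
    intro a b f g hN hf hg hx hfg
    rcases Nat.eq_zero_or_pos a with rfl | ha
    · rw [← totalDegree_zero_iff_isHomogeneous, totalDegree_eq_zero_iff_eq_C] at hf
      rw [zero_mul]
      apply hasDim_unit
      rw [hf]
      apply IsUnit.map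
      rw [isUnit_iff_ne_zero]
      intro h0; rw [h0] at hf; apply hx; rw [hf]; simp
    rcases Nat.eq_zero_or_pos b with rfl | hb
    · rw [← totalDegree_zero_iff_isHomogeneous, totalDegree_eq_zero_iff_eq_C] at hg
      rw [mul_zero]
      by_cases h0 : g = 0
      · subst h0
        exact hasDim_unit (isRelPrime_zero_right.1 hfg)
      · apply HasDim.swap
        apply hasDim_unit
        rw [hg]
        apply IsUnit.map
        rw [isUnit_iff_ne_zero]
        intro h1; rw [h1] at hg; apply h0; rw [hg]; simp
    by_cases hd : X 1 ∣ g
    · exact step a b f g ha hN hf hg hx hfg hb hd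
    rcases le_total a b with hab | hab
    · exact step2 a b f g ha hab hN hf hg hx hfg
    · rw [mul_comm]
      exact (step2 b a g f hb hab (by omega) hg hf hd hfg.symm).swap

lemma relPrime_lin (i j : ℚ) (h : i ≠ j) :
    IsRelPrime (X 0 + C i * X 1 : PP) (X 0 + C j * X 1) := by
  intro d h1 h2
  have hij : (i - j) ≠ 0 := sub_ne_zero.2 h
  have e : (C (i - j)⁻¹ : PP) * (C i - C j) = 1 := by
    rw [← C_sub, ← C_mul, inv_mul_cancel₀ hij, C_1]
  have h3 : d ∣ X 1 := by
    have := (dvd_sub h1 h2).mul_left (C (i - j)⁻¹)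
    convert this using 1
    linear_combination - X 1 * e
  have h4 : d ∣ X 0 := by
    have := dvd_sub h1 (h3.mul_left (C i))
    simpa using this
  exact X1_irr.isRelPrime_iff_not_dvd.2 not_dvd10 h3 h4

lemma not_dvd_lin (i : ℚ) : ¬ (X 1 : PP) ∣ X 0 + C i * X 1 := by
  intro h
  have := dvd_sub h (dvd_mul_left (X 1 : PP) (C i))
  exact not_dvd10 (by simpa using this)

lemma homog_lin (i : ℚ) : (X 0 + C i * X 1 : PP).IsHomogeneous 1 := by
  refine (isHomogeneous_X ℚ 0).add ?_
  simpa using (isHomogeneous_C (Fin 2) i).mul (isHomogeneous_X ℚ (1 : Fin 2))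

/-- For `n ≥ 1`, with `r_n`, `s_n` the relations of presentation (2.5) of Kiem–Moon —
defined by `2α·r_n = (ξ+α)^n(ξ+3α)^n − (ξ−α)^n(ξ−3α)^n` and
`2·s_n = (ξ+α)^n(ξ+3α)^n + (ξ−α)^n(ξ−3α)^n` — the quotient ring `ℚ[ξ,α]/⟨r_n,s_n⟩`
is a finite-dimensional `ℚ`-vector space of dimension `2n·(2n−1)`. -/
theorem stmt7 (n : ℕ) (hn : 1 ≤ n) (r s : MvPolynomial (Fin 2) ℚ)
    (hr : 2 * alVar * r =
      (xiVar + alVar) ^ n * (xiVar + 3 * alVar) ^ n -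
        (xiVar - alVar) ^ n * (xiVar - 3 * alVar) ^ n)
    (hs : 2 * s =
      (xiVar + alVar) ^ n * (xiVar + 3 * alVar) ^ n +
        (xiVar - alVar) ^ n * (xiVar - 3 * alVar) ^ n) :
    FiniteDimensional ℚ
      (MvPolynomial (Fin 2) ℚ ⧸ Ideal.span ({r, s} : Set (MvPolynomial (Fin 2) ℚ))) ∧
    Module.finrank ℚ
      (MvPolynomial (Fin 2) ℚ ⧸ Ideal.span ({r, s} : Set (MvPolynomial (Fin 2) ℚ)))
      = 2 * n * (2 * n - 1) := by
  have e1 : xiVar + alVar = X 0 + C 1 * X 1 := by simp [xiVar, alVar]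
  have h3 : (C 3 : PP) = 3 := map_ofNat C 3
  have h2 : (C 2 : PP) = 2 := map_ofNat C 2
  have e2 : xiVar + 3 * alVar = X 0 + C 3 * X 1 := by simp only [xiVar, alVar, h3]
  have e3 : xiVar - alVar = X 0 + C (-1) * X 1 := by simp [xiVar, alVar]; ring
  have e4 : xiVar - 3 * alVar = X 0 + C (-3) * X 1 := by
    rw [C_neg, h3]; simp only [xiVar, alVar]; ring
  rw [e1, e2, e3, e4] at hr hs
  have hal : alVar = X 1 := rfl
  rw [hal] at hr
  set A : PP := (X 0 + C 1 * X 1) ^ n * (X 0 + C 3 * X 1) ^ n with hA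
  set B : PP := (X 0 + C (-1) * X 1) ^ n * (X 0 + C (-3) * X 1) ^ n with hB
  have half : (C (1/2) : PP) * 2 = 1 := by rw [← h2, ← C_mul]; norm_num
  have hA' : A = s + X 1 * r := by
    linear_combination (C (1/2)) * (- hr - hs) + (s + X 1 * r - A) * half
  have hB' : B = s - X 1 * r := by
    linear_combination (C (1/2)) * (hr - hs) + (s - X 1 * r - B) * half
  have hs' : s = C (1/2) * (A + B) := by
    linear_combination C (1/2) * hs - s * half
  have hr' : X 1 * r = C (1/2) * (A - B) := by
    linear_combination C (1/2) * hr - X 1 * r * half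
  have hAh : A.IsHomogeneous (2 * n) := by
    have := ((homog_lin 1).pow n).mul ((homog_lin 3).pow n)
    convert this using 1; ring
  have hBh : B.IsHomogeneous (2 * n) := by
    have := ((homog_lin (-1)).pow n).mul ((homog_lin (-3)).pow n)
    convert this using 1; ring
  have hsh : s.IsHomogeneous (2 * n) := by
    rw [hs']
    simpa using (isHomogeneous_C (Fin 2) (1/2 : ℚ)).mul (hAh.add hBh)
  have hrh : r.IsHomogeneous (2 * n - 1) := by
    apply homog_cancel
    rw [hr', show 2 * n - 1 + 1 = 2 * n by omega]
    simpa using (isHomogeneous_C (Fin 2) (1/2 : ℚ)).mul (hAh.sub hBh)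
  have hAB : IsRelPrime A B := by
    rw [hA, hB]
    refine IsRelPrime.mul_left (IsRelPrime.mul_right ?_ ?_) (IsRelPrime.mul_right ?_ ?_) <;>
    · apply IsRelPrime.pow
      apply relPrime_lin
      norm_num
  have hrel : IsRelPrime s r := by
    intro d h1 h2
    apply hAB
    · rw [hA']; exact dvd_add h1 (h2.mul_left _)
    · rw [hB']; exact dvd_sub h1 (h2.mul_left _)
  have hx : ¬ (X 1 : PP) ∣ s := by
    intro h
    have : (X 1 : PP) ∣ A := by rw [hA']; exact dvd_add h (dvd_mul_right _ _)
    have hp : Prime (X 1 : PP) := MvPolynomial.X_prime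
    rcases hp.dvd_or_dvd this with h | h
    · exact not_dvd_lin _ (hp.dvd_of_dvd_pow h)
    · exact not_dvd_lin _ (hp.dvd_of_dvd_pow h)
  have key := (hasDim_main _ _ _ s r rfl hsh hrh hx hrel).swap
  unfold HasDim at key
  refine ⟨?_, Module.finrank_eq_of_rank_eq key⟩
  apply Module.rank_lt_aleph0_iff.1
  rw [key]
  exact Cardinal.natCast_lt_aleph0
end
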